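/- Let G be the setwise stabilizer of {α0+α1, α2+α3} in Ŵ, and set 𝐓1 = σ2∘σ1∘w2∘w3∘w0, 𝐓2 = (σ1∘σ2)²∘w0∘w3∘w1∘w0, 𝐓3 = σ1∘σ2∘w2∘w1∘w0 ∈ Ŵ. Then G equals the subgroup of Ŵ generated by the five elements w1∘w2∘w1, σ1, 𝐓1, 𝐓2∘𝐓3⁻¹, and 𝐓3⁻¹∘w3∘w2∘w3. -/

import Mathlib

open Pointwise

/-- The Picard lattice `Pic`, with basis `H1, H2, E1, …, E8`
(coordinates `0 ↦ H1`, `1 ↦ H2`, `i+1 ↦ Eᵢ`). -/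
abbrev Pic : Type := Fin 10 → ℤ

/-- The intersection form `•` : `H1•H2 = 1`, `Eᵢ•Eᵢ = -1`, all other pairings
of basis vectors being `0`. -/
def inter (x y : Pic) : ℤ :=
  x 0 * y 1 + x 1 * y 0 -
    (x 2 * y 2 + x 3 * y 3 + x 4 * y 4 + x 5 * y 5 + x 6 * y 6 +
      x 7 * y 7 + x 8 * y 8 + x 9 * y 9)

/-- The `j`-th basis vector of `Pic`. -/
def bvec (j : Fin 10) : Pic := fun k => if k = j then 1 else 0

/-- The matrix of the reflection `C ↦ C + (C • a)·a` in `a`. -/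
def reflMat (a : Pic) : Matrix (Fin 10) (Fin 10) ℤ :=
  Matrix.of fun k j => (if k = j then 1 else 0) + inter (bvec j) a * a k

/-- The matrix of the linear map sending the basis vector `e j` to `e (p j)`. -/
def permMat (p : Fin 10 → Fin 10) : Matrix (Fin 10) (Fin 10) ℤ :=
  Matrix.of fun k j => if p j = k then 1 else 0

/-- `α₀ = H2 - E1 - E2`. -/
def al0 : Pic := ![0, 1, -1, -1, 0, 0, 0, 0, 0, 0]
/-- `α₁ = H1 - E5 - E6`. -/
def al1 : Pic := ![1, 0, 0, 0, 0, 0, -1, -1, 0, 0]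
/-- `α₂ = H2 - E3 - E4`. -/
def al2 : Pic := ![0, 1, 0, 0, -1, -1, 0, 0, 0, 0]
/-- `α₃ = H1 - E7 - E8`. -/
def al3 : Pic := ![1, 0, 0, 0, 0, 0, 0, 0, -1, -1]
/-- `δ = 2H1 + 2H2 - E1 - ⋯ - E8`. -/
def dl : Pic := ![2, 2, -1, -1, -1, -1, -1, -1, -1, -1]
/-- `μ = H1 - H2`. -/
def mu : Pic := ![1, -1, 0, 0, 0, 0, 0, 0, 0, 0]

/-- Automorphisms of the lattice `Pic`, realized as invertible integer `10 × 10`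
matrices (acting on coordinate vectors by matrix-vector multiplication). -/
abbrev PicAut : Type := (Matrix (Fin 10) (Fin 10) ℤ)ˣ

/-- Build an automorphism of `Pic` out of an involutive matrix. -/
def mkAut (M : Matrix (Fin 10) (Fin 10) ℤ) (h : M * M = 1) : PicAut := ⟨M, M, h, h⟩

/-- `w₀`, the reflection `C ↦ C + (C•α₀)α₀`. -/
def w0 : PicAut := mkAut (reflMat al0) (by decide)
/-- `w₁`, the reflection `C ↦ C + (C•α₁)α₁`. -/
def w1 : PicAut := mkAut (reflMat al1) (by decide)
/-- `w₂`, the reflection `C ↦ C + (C•α₂)α₂`. -/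
def w2 : PicAut := mkAut (reflMat al2) (by decide)
/-- `w₃`, the reflection `C ↦ C + (C•α₃)α₃`. -/
def w3 : PicAut := mkAut (reflMat al3) (by decide)
/-- `σ₁`: the basis permutation `E1↔E7, E2↔E8, E3↔E5, E4↔E6` (fixing `H1`, `H2`)
composed with the reflection `w_μ` in `μ = H1 - H2`. -/
def sg1 : PicAut := mkAut (permMat ![0, 1, 8, 9, 6, 7, 4, 5, 2, 3] * reflMat mu) (by decide)
/-- `σ₂`: the basis permutation `E1↔E3, E2↔E4` (fixing the other basis vectors). -/
def sg2 : PicAut := mkAut (permMat ![0, 1, 4, 5, 2, 3, 6, 7, 8, 9]) (by decide)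
/-- `σ₃`: the basis permutation `E5↔E7, E6↔E8` (fixing the other basis vectors). -/
def sg3 : PicAut := mkAut (permMat ![0, 1, 2, 3, 4, 5, 8, 9, 6, 7]) (by decide)

/-- The action of an automorphism on `Pic`. -/
def act (g : PicAut) (v : Pic) : Pic := g.val.mulVec v

instance : MulAction PicAut Pic where
  smul := act
  one_smul v := by
    show act 1 v = v
    simp [act]
  mul_smul g h v := by
    show act (g * h) v = act g (act h v)
    simp [act, Matrix.mulVec_mulVec]

lemma smul_eq_act (g : PicAut) (v : Pic) : g • v = act g v := rfl

/-- The fully extended affine Weyl group `Ŵ` of type `A₃⁽¹⁾`, i.e. the subgroup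
of automorphisms of `Pic` generated by `w₀, w₁, w₂, w₃, σ₁, σ₂`. -/
def Wh : Subgroup PicAut := Subgroup.closure {w0, w1, w2, w3, sg1, sg2}

/-- The two-element set `{α₀+α₁, α₂+α₃} ⊆ Pic`. -/
def Spair : Set Pic := {al0 + al1, al2 + al3}

/-- `𝐓₁ = σ₂σ₁w₂w₃w₀`. -/
def T1 : PicAut := sg2 * sg1 * w2 * w3 * w0
/-- `𝐓₂ = (σ₁σ₂)²w₀w₃w₁w₀`. -/
def T2 : PicAut := (sg1 * sg2) ^ 2 * w0 * w3 * w1 * w0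
/-- `𝐓₃ = σ₁σ₂w₂w₁w₀`. -/
def T3 : PicAut := sg1 * sg2 * w2 * w1 * w0

/-- The subgroup generated by `w₁w₂w₁`, `σ₁`, `𝐓₁`, `𝐓₂𝐓₃⁻¹` and `𝐓₃⁻¹w₃w₂w₃`. -/
def stabGen : Subgroup PicAut :=
  Subgroup.closure {w1 * w2 * w1, sg1, T1, T2 * T3⁻¹, T3⁻¹ * w3 * w2 * w3}

lemma w121_mem : w1 * w2 * w1 ∈ stabGen := Subgroup.subset_closure (by simp)

lemma sg1_mem : sg1 ∈ stabGen := Subgroup.subset_closure (by simp)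

lemma T1_mem : T1 ∈ stabGen := Subgroup.subset_closure (by simp)

lemma T23_mem : T2 * T3⁻¹ ∈ stabGen := Subgroup.subset_closure (by simp)

lemma T3w323_mem : T3⁻¹ * w3 * w2 * w3 ∈ stabGen := Subgroup.subset_closure (by simp)

section Translations

variable {G : Type*} [Group G]

/-- The elements `x` for which `tⁿ x ∈ H ⟨t⟩` for every integer `n`. -/
def MovesPast (H : Subgroup G) (t x : G) : Prop :=
  ∀ n : ℤ, ∃ h ∈ H, ∃ m : ℤ, t ^ n * x = h * t ^ m

variable {H : Subgroup G} {t x y : G}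

lemma MovesPast.mul (hx : MovesPast H t x) (hy : MovesPast H t y) : MovesPast H t (x * y) := by
  intro n
  obtain ⟨h, hh, m, e⟩ := hx n
  obtain ⟨h', hh', m', e'⟩ := hy m
  exact ⟨h * h', mul_mem hh hh', m', by rw [← mul_assoc, e, mul_assoc, e', mul_assoc]⟩

lemma MovesPast.of_commute (hx : x ∈ H) (hc : Commute t x) : MovesPast H t x :=
  fun n => ⟨x, hx, n, (hc.zpow_left n).eq⟩

lemma MovesPast.of_inverts (hx : x ∈ H) (hc : Commute t (x * x)) (ht : x * t * x = t⁻¹) :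
    MovesPast H t x := by
  intro n
  have hconj : x * t * x⁻¹ = t⁻¹ * (x * x)⁻¹ := by rw [← ht]; group
  have hpow : x * t ^ (-n) * x⁻¹ = t ^ n * (x * x) ^ n := by
    rw [← conj_zpow, hconj, (hc.inv_inv).mul_zpow, inv_zpow', inv_zpow', neg_neg]
  refine ⟨((x * x) ^ n)⁻¹ * x, mul_mem (inv_mem (zpow_mem (mul_mem hx hx) n)) hx, -n, ?_⟩
  rw [mul_assoc, mul_inv_eq_iff_eq_mul.mp hpow, (hc.zpow_zpow n n).eq]
  group

lemma MovesPast.inv_of_inverts (hx : x ∈ H) (hc : Commute t (x * x)) (ht : x * t * x = t⁻¹) :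
    MovesPast H t x⁻¹ := by
  have h := (MovesPast.of_inverts hx hc ht).mul
    (MovesPast.of_commute (inv_mem (mul_mem hx hx)) hc.inv_right)
  simpa using h

lemma MovesPast.of_mem_closure {S : Set G}
    (hS : ∀ x ∈ S, MovesPast H t x ∧ MovesPast H t x⁻¹) (hx : x ∈ Subgroup.closure S) :
    MovesPast H t x := by
  induction hx using Subgroup.closure_induction_right with
  | one => exact MovesPast.of_commute (one_mem H) (Commute.one_right t)
  | mul_right x _ y hy ih => exact ih.mul (hS y hy).1
  | mul_inv_cancel x _ y hy ih => exact ih.mul (hS y hy).2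

end Translations

lemma movesPast_T3 {x : PicAut} (hx : x ∈ stabGen) : MovesPast stabGen T3 x := by
  have hcomm : ∀ {y : PicAut}, y ∈ stabGen → Commute T3 y →
      MovesPast stabGen T3 y ∧ MovesPast stabGen T3 y⁻¹ := fun hy hc =>
    ⟨MovesPast.of_commute hy hc, MovesPast.of_commute (inv_mem hy) hc.inv_right⟩
  have hinv : ∀ {y : PicAut}, y ∈ stabGen → Commute T3 (y * y) → y * T3 * y = T3⁻¹ →
      MovesPast stabGen T3 y ∧ MovesPast stabGen T3 y⁻¹ := fun hy hc ht =>
    ⟨MovesPast.of_inverts hy hc ht, MovesPast.inv_of_inverts hy hc ht⟩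
  refine MovesPast.of_mem_closure ?_ hx
  rintro y (rfl | rfl | rfl | rfl | rfl)
  · exact hcomm w121_mem (Units.ext (by decide +kernel))
  · exact hinv sg1_mem (Units.ext (by decide +kernel)) (Units.ext (by decide +kernel))
  · exact hcomm T1_mem (Units.ext (by decide +kernel))
  · exact hcomm T23_mem (Units.ext (by decide +kernel))
  · exact hinv T3w323_mem (Units.ext (by decide +kernel)) (Units.ext (by decide +kernel))

/-- The product set `stabGen ⟨𝐓₃⟩`. -/
def stabT3 : Set PicAut := {g | ∃ h ∈ stabGen, ∃ n : ℤ, g = h * T3 ^ n}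

lemma stabT3_mul {x y : PicAut} (hx : x ∈ stabT3) (hy : y ∈ stabT3) : x * y ∈ stabT3 := by
  obtain ⟨h, hh, n, rfl⟩ := hx
  obtain ⟨k, hk, m, rfl⟩ := hy
  obtain ⟨k', hk', n', e⟩ := movesPast_T3 hk n
  exact ⟨h * k', mul_mem hh hk', n' + m, by
    rw [zpow_add, mul_assoc, ← mul_assoc (T3 ^ n), e]; simp only [mul_assoc]⟩

lemma mem_stabT3_of_mem {x : PicAut} (hx : x ∈ stabGen) : x ∈ stabT3 := ⟨x, hx, 0, by simp⟩

/-- Representatives of the cosets of `stabGen ⟨𝐓₃⟩` in `Ŵ`. -/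
def cosetReps : Set PicAut := {1, sg2, w1, w1 * sg2, w1 * sg1, w1 * sg2 * sg1}

/-- The union of the cosets of `stabGen ⟨𝐓₃⟩` with representative in `cosetReps`. -/
def cosetUnion : Set PicAut := {g | ∃ m ∈ stabT3, ∃ s ∈ cosetReps, g = m * s}

lemma sg1_mul_self : sg1 * sg1 = 1 := Units.ext (by decide +kernel)

lemma sg2_mul_self : sg2 * sg2 = 1 := Units.ext (by decide +kernel)

lemma w1_mul_self : w1 * w1 = 1 := Units.ext (by decide +kernel)

lemma sg2_mul_w1 : sg2 * w1 = w1 * sg2 := Units.ext (by decide +kernel)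

lemma sg2_mul_sg1 :
    sg2 * sg1 =
      w1 * w2 * w1 * sg1 * T1 * (T3⁻¹ * w3 * w2 * w3) * sg2 :=
  Units.ext (by decide +kernel)

lemma w1_mul_sg1_mul_sg2 :
    w1 * sg1 * sg2 = sg1 * (T3⁻¹ * w3 * w2 * w3) * (w1 * sg1) :=
  Units.ext (by decide +kernel)

lemma w1_mul_sg2_mul_sg1_mul_sg2 :
    w1 * sg2 * sg1 * sg2 = sg1 * (T3⁻¹ * w3 * w2 * w3) * (w1 * sg2 * sg1) :=
  Units.ext (by decide +kernel)

lemma w1_mul_sg1_mul_w1 : w1 * sg1 * w1 = w1 * w2 * w1 * (w1 * sg1) :=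
  Units.ext (by decide +kernel)

lemma w1_mul_sg2_mul_sg1_mul_w1 :
    w1 * sg2 * sg1 * w1 = T3⁻¹ * w3 * w2 * w3 * T3 * (w1 * sg2 * sg1) :=
  Units.ext (by decide +kernel)

lemma cosetReps_mul {s g : PicAut} (hs : s ∈ cosetReps) (hg : g ∈ ({sg1, sg2, w1} : Set PicAut)) :
    s * g ∈ cosetUnion := by
  have hrep : ∀ {r : PicAut}, r ∈ cosetReps → r ∈ cosetUnion := fun {r} hr =>
    ⟨1, mem_stabT3_of_mem (one_mem _), r, hr, (one_mul r).symm⟩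
  have hstep : ∀ {x m r : PicAut}, x = m * r → m ∈ stabT3 → r ∈ cosetReps → x ∈ cosetUnion :=
    fun h hm hr => ⟨_, hm, _, hr, h⟩
  have hV := mul_mem sg1_mem T3w323_mem
  rcases hs with rfl | rfl | rfl | rfl | rfl | rfl <;> rcases hg with rfl | rfl | rfl
  · exact hstep ((one_mul sg1).trans (mul_one sg1).symm) (mem_stabT3_of_mem sg1_mem) (by simp [cosetReps])
  · exact hrep (by simp [cosetReps])
  · exact hrep (by simp [cosetReps])
  · exact hstep sg2_mul_sg1 (mem_stabT3_of_mem (mul_mem (mul_mem (mul_mem w121_mem sg1_mem)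
      T1_mem) T3w323_mem)) (by simp [cosetReps])
  · exact hrep (by simp [cosetReps, sg2_mul_self])
  · exact hrep (by simp [cosetReps, sg2_mul_w1])
  · exact hrep (by simp [cosetReps])
  · exact hrep (by simp [cosetReps])
  · exact hrep (by simp [cosetReps, w1_mul_self])
  · exact hrep (by simp [cosetReps])
  · exact hrep (by simp [cosetReps, mul_assoc, sg2_mul_self])
  · rw [mul_assoc, sg2_mul_w1, ← mul_assoc, w1_mul_self, one_mul]
    exact hrep (by simp [cosetReps])
  · exact hrep (by simp [cosetReps, mul_assoc, sg1_mul_self])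
  · exact hstep w1_mul_sg1_mul_sg2 (mem_stabT3_of_mem hV) (by simp [cosetReps])
  · exact hstep w1_mul_sg1_mul_w1 (mem_stabT3_of_mem w121_mem) (by simp [cosetReps])
  · exact hrep (by simp [cosetReps, mul_assoc, sg1_mul_self])
  · exact hstep w1_mul_sg2_mul_sg1_mul_sg2 (mem_stabT3_of_mem hV) (by simp [cosetReps])
  · exact hstep w1_mul_sg2_mul_sg1_mul_w1 ⟨_, T3w323_mem, 1, by rw [zpow_one]⟩
      (by simp [cosetReps])

lemma Wh_le_closure : Wh ≤ Subgroup.closure {sg1, sg2, w1} := by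
  have h1 : sg1 ∈ Subgroup.closure {sg1, sg2, w1} := Subgroup.subset_closure (by simp)
  have h2 : sg2 ∈ Subgroup.closure {sg1, sg2, w1} := Subgroup.subset_closure (by simp)
  have h3 : w1 ∈ Subgroup.closure {sg1, sg2, w1} := Subgroup.subset_closure (by simp)
  have e2 : w2 = sg1 * w1 * sg1 := Units.ext (by decide +kernel)
  have e0 : w0 = sg2 * w2 * sg2 := Units.ext (by decide +kernel)
  have e3 : w3 = sg1 * w0 * sg1 := Units.ext (by decide +kernel)
  have m2 : w2 ∈ Subgroup.closure {sg1, sg2, w1} := e2 ▸ mul_mem (mul_mem h1 h3) h1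
  have m0 : w0 ∈ Subgroup.closure {sg1, sg2, w1} := e0 ▸ mul_mem (mul_mem h2 m2) h2
  have m3 : w3 ∈ Subgroup.closure {sg1, sg2, w1} := e3 ▸ mul_mem (mul_mem h1 m0) h1
  refine (Subgroup.closure_le _).2 ?_
  rintro g (rfl | rfl | rfl | rfl | rfl | rfl)
  exacts [m0, h3, m2, m3, h1, h2]

lemma mem_cosetUnion {g : PicAut} (hg : g ∈ Wh) : g ∈ cosetUnion := by
  have hmul : ∀ x ∈ cosetUnion, ∀ y ∈ ({sg1, sg2, w1} : Set PicAut), x * y ∈ cosetUnion := by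
    rintro _ ⟨m, hm, s, hs, rfl⟩ y hy
    obtain ⟨m', hm', s', hs', e⟩ := cosetReps_mul hs hy
    exact ⟨m * m', stabT3_mul hm hm', s', hs', by rw [mul_assoc, e, mul_assoc]⟩
  replace hg := Wh_le_closure hg
  induction hg using Subgroup.closure_induction_right with
  | one => exact ⟨1, mem_stabT3_of_mem (one_mem _), 1, by simp [cosetReps], by simp⟩
  | mul_right x _ y hy ih => exact hmul x ih y hy
  | mul_inv_cancel x _ y hy ih =>
    have hyy : y⁻¹ = y := by
      rcases hy with rfl | rfl | rfl
      · exact inv_eq_of_mul_eq_one_left sg1_mul_self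
      · exact inv_eq_of_mul_eq_one_left sg2_mul_self
      · exact inv_eq_of_mul_eq_one_left w1_mul_self
    exact hyy ▸ hmul x ih y hy

lemma act_mul (g h : PicAut) (v : Pic) : act (g * h) v = act g (act h v) := by
  simp [act, Matrix.mulVec_mulVec]

lemma act_one (v : Pic) : act 1 v = v := by simp [act]

lemma act_T3_zpow {v : Pic} {c : ℤ} (h : act T3 v = v + c • dl) (n : ℤ) :
    act (T3 ^ n) v = v + (n * c) • dl := by
  have hd : act T3 dl = dl := by decide +kernel
  have hstep : ∀ k : ℤ, act T3 (v + (k * c) • dl) = v + ((k + 1) * c) • dl := by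
    intro k
    have hlin : act T3 (v + (k * c) • dl) = act T3 v + (k * c) • act T3 dl := by
      rw [act, Matrix.mulVec_add, Matrix.mulVec_smul]; rfl
    rw [hlin, hd, h]
    module
  induction n using Int.induction_on with
  | zero => simp [act_one]
  | succ k ih => rw [add_comm (k : ℤ) 1, zpow_one_add, act_mul, ih, hstep, add_comm (1 : ℤ)]
  | pred k ih =>
    have h' := hstep (-k - 1)
    rw [sub_add_cancel] at h'
    have hcancel : ∀ u : Pic, act T3⁻¹ (act T3 u) = u := fun u => by
      rw [← act_mul, inv_mul_cancel, act_one]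
    rw [sub_eq_neg_add, zpow_add, zpow_neg_one, act_mul, ih, ← h', hcancel, ← sub_eq_neg_add]

/-- Among the elements `𝐓₃ⁿ s` with `s` a coset representative, only the identity maps
`α₀ + α₁` into the pair. -/
lemma eq_one_of_act_mem {n : ℤ} {s : PicAut} (hs : s ∈ cosetReps)
    (h : act (T3 ^ n * s) (al0 + al1) ∈ Spair) : n = 0 ∧ s = 1 := by
  rw [act_mul] at h
  have key : ∀ (u : Pic) (c : ℤ), act s (al0 + al1) = u → act T3 u = u + c • dl →
      u + (n * c) • dl = al0 + al1 ∨ u + (n * c) • dl = al2 + al3 := by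
    intro u c hu hc
    rw [hu, act_T3_zpow hc] at h
    exact h
  have coord : ∀ {u v : Pic}, u = v → u 2 = v 2 ∧ u 4 = v 4 ∧ u 6 = v 6 ∧ u 8 = v 8 := by
    rintro u _ rfl
    simp
  rcases hs with rfl | rfl | rfl | rfl | rfl | rfl
  · rcases key (al0 + al1) (-1) (by decide +kernel) (by decide +kernel) with e | e <;>
      have := coord e <;> simp [al0, al1, al2, al3, dl] at this ⊢ <;> omega
  · rcases key (al1 + al2) 0 (by decide +kernel) (by decide +kernel) with e | e <;>
      have := coord e <;> simp [al0, al1, al2, al3, dl] at this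
  · rcases key al0 (-1) (by decide +kernel) (by decide +kernel) with e | e <;>
      have := coord e <;> simp [al0, al1, al2, al3, dl] at this <;> omega
  · rcases key al2 0 (by decide +kernel) (by decide +kernel) with e | e <;>
      have := coord e <;> simp [al0, al1, al2, al3, dl] at this
  · rcases key (al1 + al2 + al3) 1 (by decide +kernel) (by decide +kernel) with e | e <;>
      have := coord e <;> simp [al0, al1, al2, al3, dl] at this <;> omega
  · rcases key (al0 + al1 + al3) 0 (by decide +kernel) (by decide +kernel) with e | e <;>
      have := coord e <;> simp [al0, al1, al2, al3, dl] at this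

lemma stabGen_le_stabilizer : stabGen ≤ MulAction.stabilizer PicAut Spair := by
  have hfix : ∀ {g : PicAut}, act g (al0 + al1) = al0 + al1 → act g (al2 + al3) = al2 + al3 →
      g ∈ MulAction.stabilizer PicAut Spair := by
    intro g h1 h2
    show act g '' {al0 + al1, al2 + al3} = {al0 + al1, al2 + al3}
    rw [Set.image_pair, h1, h2]
  have hswap : ∀ {g : PicAut}, act g (al0 + al1) = al2 + al3 → act g (al2 + al3) = al0 + al1 →
      g ∈ MulAction.stabilizer PicAut Spair := by
    intro g h1 h2
    show act g '' {al0 + al1, al2 + al3} = {al0 + al1, al2 + al3}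
    rw [Set.image_pair, h1, h2, Set.pair_comm]
  refine (Subgroup.closure_le _).2 ?_
  rintro g (rfl | rfl | rfl | rfl | rfl)
  · exact hfix (by decide +kernel) (by decide +kernel)
  · exact hswap (by decide +kernel) (by decide +kernel)
  · exact hfix (by decide +kernel) (by decide +kernel)
  · exact hfix (by decide +kernel) (by decide +kernel)
  · exact hswap (by decide +kernel) (by decide +kernel)

lemma stabGen_le_Wh : stabGen ≤ Wh := by
  have h0 : w0 ∈ Wh := Subgroup.subset_closure (by simp)
  have h1 : w1 ∈ Wh := Subgroup.subset_closure (by simp)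
  have h2 : w2 ∈ Wh := Subgroup.subset_closure (by simp)
  have h3 : w3 ∈ Wh := Subgroup.subset_closure (by simp)
  have hs1 : sg1 ∈ Wh := Subgroup.subset_closure (by simp)
  have hs2 : sg2 ∈ Wh := Subgroup.subset_closure (by simp)
  have hT1 : T1 ∈ Wh := mul_mem (mul_mem (mul_mem (mul_mem hs2 hs1) h2) h3) h0
  have hT2 : T2 ∈ Wh :=
    mul_mem (mul_mem (mul_mem (mul_mem (pow_mem (mul_mem hs1 hs2) 2) h0) h3) h1) h0
  have hT3 : T3 ∈ Wh := mul_mem (mul_mem (mul_mem (mul_mem hs1 hs2) h2) h1) h0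
  refine (Subgroup.closure_le _).2 ?_
  rintro g (rfl | rfl | rfl | rfl | rfl)
  · exact mul_mem (mul_mem h1 h2) h1
  · exact hs1
  · exact hT1
  · exact mul_mem hT2 (inv_mem hT3)
  · exact mul_mem (mul_mem (mul_mem (inv_mem hT3) h3) h2) h3

/-- The setwise stabilizer of `{α₀+α₁, α₂+α₃}` in `Ŵ` is generated by
`w₁w₂w₁`, `σ₁`, `𝐓₁`, `𝐓₂𝐓₃⁻¹` and `𝐓₃⁻¹w₃w₂w₃`. -/
theorem stmt2 :
    ∀ g : PicAut, (g ∈ Wh ∧ act g '' Spair = Spair) ↔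
      g ∈ Subgroup.closure {w1 * w2 * w1, sg1, T1, T2 * T3⁻¹, T3⁻¹ * w3 * w2 * w3} := by
  intro g
  refine ⟨fun ⟨hW, hS⟩ => ?_, fun hg => ⟨stabGen_le_Wh hg, stabGen_le_stabilizer hg⟩⟩
  obtain ⟨_, ⟨h, hh, n, rfl⟩, s, hs, rfl⟩ := mem_cosetUnion hW
  have hstab : T3 ^ n * s ∈ MulAction.stabilizer PicAut Spair := by
    rw [← mul_mem_cancel_left (stabGen_le_stabilizer hh), ← mul_assoc]
    exact hS
  have himage : act (T3 ^ n * s) '' Spair = Spair := hstab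
  have hmem : act (T3 ^ n * s) (al0 + al1) ∈ Spair :=
    himage ▸ Set.mem_image_of_mem _ (Set.mem_insert _ _)
  obtain ⟨rfl, rfl⟩ := eq_one_of_act_mem hs hmem
  simpa [stabGen] using hh
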